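/- arXiv:1912.06524 — 4 statements merged into one kernel-verified Lean document; each statement's English description precedes it below -/
import Mathlib

section
/- Let C > 0, let h₁ > 0 satisfy C·e^(−h₁) < 1, and let h₂ ∈ (0,1). Let (p_k)_{k≥1} and (δ_k)_{k≥1} be sequences of nonnegative reals such that: (a) p₁ ≤ exp(−h₁ − 2h₂); (b) p_{k+1} ≤ C·(p_k² + δ_k) for every k ≥ 1; and (c) C·δ_k·exp(h₁ + 2^(k+1)/(k+1)) ≤ 1 − C·e^(−h₁) for every k ≥ 1. Then for every k ≥ 1, p_k ≤ exp(−h₁ − (2^k/k)·h₂). -/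
/-- The renormalization induction: if `p₁ ≤ exp(-h₁ - 2h₂)`, the recursion
`p_{k+1} ≤ C (p_k² + δ_k)` holds, and the decoupling errors `δ_k` satisfy
`C δ_k exp(h₁ + 2^{k+1}/(k+1)) ≤ 1 - C e^{-h₁}`, then `p_k ≤ exp(-h₁ - (2^k/k) h₂)`
for every `k ≥ 1`. -/
theorem renormalization_induction (C h₁ h₂ : ℝ) (hC : 0 < C) (hh₁ : 0 < h₁)
    (hCh : C * Real.exp (-h₁) < 1) (hh₂0 : 0 < h₂) (hh₂1 : h₂ < 1)
    (p δ : ℕ → ℝ) (hp : ∀ k, 1 ≤ k → 0 ≤ p k) (hδ : ∀ k, 1 ≤ k → 0 ≤ δ k)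
    (hp1 : p 1 ≤ Real.exp (-h₁ - 2 * h₂))
    (hrec : ∀ k, 1 ≤ k → p (k + 1) ≤ C * (p k ^ 2 + δ k))
    (herr : ∀ k, 1 ≤ k →
      C * δ k * Real.exp (h₁ + 2 ^ (k + 1) / ((k : ℝ) + 1)) ≤ 1 - C * Real.exp (-h₁)) :
    ∀ k, 1 ≤ k → p k ≤ Real.exp (-h₁ - 2 ^ k / (k : ℝ) * h₂) := by
  intro k hk
  induction k, hk using Nat.le_induction with
  | base => simpa using hp1
  | succ k hk ih =>
    have hk0 : (0 : ℝ) < k := by exact_mod_cast hk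
    push_cast
    set a : ℝ := 2 ^ k / (k : ℝ) with ha
    set b : ℝ := 2 ^ (k + 1) / ((k : ℝ) + 1) with hb
    have hb0 : 0 ≤ b := by positivity
    have hba : b ≤ 2 * a := by
      calc b ≤ 2 ^ (k + 1) / (k : ℝ) := by rw [hb]; gcongr; linarith
        _ = 2 * a := by rw [ha]; ring
    have hδk : 0 ≤ C * δ k := mul_nonneg hC.le (hδ k hk)
    have hsq : p k ^ 2 * Real.exp (h₁ + b * h₂) ≤ Real.exp (-h₁) := by
      calc p k ^ 2 * Real.exp (h₁ + b * h₂)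
          ≤ Real.exp (-h₁ - a * h₂) ^ 2 * Real.exp (h₁ + b * h₂) := by
            gcongr
            exact hp k hk
        _ = Real.exp (-h₁ - (2 * a - b) * h₂) := by
            rw [← Real.exp_nat_mul, ← Real.exp_add]
            congr 1
            push_cast
            ring
        _ ≤ Real.exp (-h₁) := by
            apply Real.exp_le_exp.mpr
            nlinarith
    have hdec : C * δ k * Real.exp (h₁ + b * h₂) ≤ 1 - C * Real.exp (-h₁) := by
      refine le_trans ?_ (herr k hk)
      gcongr
      exact mul_le_of_le_one_right hb0 hh₂1.le
    have hprod : C * (p k ^ 2 + δ k) * Real.exp (h₁ + b * h₂) ≤ 1 := by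
      linarith [mul_le_mul_of_nonneg_left hsq hC.le]
    calc p (k + 1) ≤ C * (p k ^ 2 + δ k) := hrec k hk
      _ ≤ 1 / Real.exp (h₁ + b * h₂) := (le_div_iff₀ (Real.exp_pos _)).mpr hprod
      _ = Real.exp (-h₁ - b * h₂) := by
        rw [one_div, ← Real.exp_neg]
        congr 1
        ring
end

section
/- Let d ≥ 1 and let L, L' be reals with 0 < 2L ≤ L'. Let ω : ℤ^d → {0,1} be a configuration. Let (x_i)_{i∈I} and (y_j)_{j∈J} be finite families of points of ℤ^d such that: (a) each x_i lies in the real box [0,L')^d; (b) C_0(L') ⊆ ∪_{i∈I} C_{x_i}(L); (c) for each j, the real boxes ([0,L)^d + y_j) and [−L',2L')^d are disjoint; and (d) every site z ∈ ℤ^d \ D_0(L') at ‖·‖_1-distance 1 from some site of D_0(L') belongs to ∪_{j∈J} C_{y_j}(L). If ω ∈ A_0(L'), then there exist i ∈ I and j ∈ J such that ω ∈ A_{x_i}(L) and ω ∈ A_{y_j}(L). -/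
open Filter

/-- Sites of the lattice `ℤ^d`. -/
abbrev Site (d : ℕ) := Fin d → ℤ

/-- The `ℓ¹` distance between two sites. -/
def dist1 {d : ℕ} (z w : Site d) : ℤ := ∑ i, |z i - w i|

/-- The sup norm `‖x‖_∞` of a site, as a natural number. -/
def supNorm {d : ℕ} (x : Site d) : ℕ := Finset.univ.sup fun i => (x i).natAbs

/-- The lattice box `C_x(L) = ℤ^d ∩ ([0,L)^d + x)`. -/
def boxC {d : ℕ} (x : Site d) (L : ℝ) : Set (Site d) :=
  {z | ∀ i, (x i : ℝ) ≤ (z i : ℝ) ∧ (z i : ℝ) < (x i : ℝ) + L}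

/-- The lattice box `D_x(L) = ℤ^d ∩ ([-L,2L)^d + x)`. -/
def boxD {d : ℕ} (x : Site d) (L : ℝ) : Set (Site d) :=
  {z | ∀ i, (x i : ℝ) - L ≤ (z i : ℝ) ∧ (z i : ℝ) < (x i : ℝ) + 2 * L}

/-- `A ↔ B` in the configuration `ω`: there is a nearest-neighbor path of open sites
starting in `A` and ending in `B`. -/
def Connects {d : ℕ} (ω : Site d → Bool) (A B : Set (Site d)) : Prop :=
  ∃ (m : ℕ) (z : ℕ → Site d),
    (∀ s ≤ m, ω (z s) = true) ∧ z 0 ∈ A ∧ z m ∈ B ∧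
      ∀ s < m, dist1 (z (s + 1)) (z s) = 1

/-- The annulus-crossing event `A_x(L) = {C_x(L) ↔ ℤ^d \ D_x(L)}`. -/
def annulusEvent {d : ℕ} (x : Site d) (L : ℝ) : Set (Site d → Bool) :=
  {ω | Connects ω (boxC x L) (boxD x L)ᶜ}


theorem dist1_comm {d : ℕ} (z w : Site d) : dist1 z w = dist1 w z := by
  simp only [dist1, abs_sub_comm]

theorem Connects.symm {d : ℕ} {ω : Site d → Bool} {A B : Set (Site d)}
    (h : Connects ω A B) : Connects ω B A := by
  obtain ⟨m, z, ho, h0, hm, hs⟩ := h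
  refine ⟨m, fun s => z (m - s), fun s _ => ho _ (Nat.sub_le m s), by simpa using hm,
    by simpa using h0, fun s hsm => ?_⟩
  have h := hs (m - (s + 1)) (by omega)
  rwa [show m - (s + 1) + 1 = m - s by omega, dist1_comm] at h

theorem Connects.mono {d : ℕ} {ω : Site d → Bool} {A A' B B' : Set (Site d)}
    (h : Connects ω A B) (hA : A ⊆ A') (hB : B ⊆ B') : Connects ω A' B' := by
  obtain ⟨m, z, ho, h0, hm, hs⟩ := h
  exact ⟨m, z, ho, hA h0, hB hm, hs⟩

/-- A path from `A` to the complement of `D ⊇ A` can be stopped at its first exit from `D`,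
which is a neighbor of `D`. -/
theorem Connects.exists_first_exit {d : ℕ} {ω : Site d → Bool} {A D : Set (Site d)}
    (h : Connects ω A Dᶜ) (hAD : A ⊆ D) :
    ∃ a ∈ A, ∃ b ∉ D, (∃ w ∈ D, dist1 b w = 1) ∧ Connects ω {a} {b} := by
  classical
  obtain ⟨m, z, ho, h0, hm, hs⟩ := h
  have hex : ∃ n, z n ∉ D := ⟨m, hm⟩
  obtain ⟨n, hn, hmin⟩ : ∃ n, z n ∉ D ∧ ∀ k < n, z k ∈ D :=
    ⟨Nat.find hex, Nat.find_spec hex, fun k hk => not_not.mp (Nat.find_min hex hk)⟩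
  have hnm : n ≤ m := not_lt.mp fun hlt => hm (hmin m hlt)
  obtain _ | k := n
  · exact absurd (hAD h0) hn
  · exact ⟨z 0, h0, z (k + 1), hn, ⟨z k, hmin k k.lt_succ_self, hs k hnm⟩,
      k + 1, z, fun s hsk => ho s (hsk.trans hnm), rfl, rfl,
      fun s hsk => hs s (hsk.trans_le hnm)⟩

theorem boxC_subset_boxD {d : ℕ} (x : Site d) {L : ℝ} (hL : 0 ≤ L) : boxC x L ⊆ boxD x L :=
  fun _ hz t => ⟨by linarith [(hz t).1], by linarith [(hz t).2]⟩

theorem boxD_subset_boxD_zero {d : ℕ} {x : Site d} {L L' : ℝ} (hL : 0 ≤ L) (hLL' : 2 * L ≤ L')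
    (hx : ∀ t, (0 : ℝ) ≤ x t ∧ (x t : ℝ) < L') : boxD x L ⊆ boxD 0 L' := by
  intro z hz t
  have h1 := hz t
  have h2 := hx t
  simp only [Pi.zero_apply, Int.cast_zero]
  constructor <;> linarith

/-- If the real box of side `L` at `y` misses `[-L', 2L')^d`, then `C_0(L')` lies outside
`D_y(L)`. -/
theorem boxC_zero_subset_compl_boxD {d : ℕ} {y : Site d} {L L' : ℝ} (hL : 0 < L)
    (hLL' : L ≤ L')
    (hy : ¬ ∃ p : Fin d → ℝ, (∀ t, (y t : ℝ) ≤ p t ∧ p t < (y t : ℝ) + L) ∧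
      (∀ t, -L' ≤ p t ∧ p t < 2 * L')) :
    boxC 0 L' ⊆ (boxD y L)ᶜ := by
  intro z hz hzD
  refine hy ⟨fun t => max (y t) (-L'),
    fun t => ⟨le_max_left _ _, max_lt (by linarith) ?_⟩,
    fun t => ⟨le_max_right _ _, max_lt ?_ (by linarith)⟩⟩ <;>
  · have h1 := hz t
    have h2 := hzD t
    simp only [Pi.zero_apply, Int.cast_zero] at h1
    linarith

/-- The deterministic cascading step: a crossing of the annulus at the
larger scale `L'` forces two crossings of annuli at the smaller scale `L`, one centered at
some `x i` (covering `C_0(L')`) and one centered at some `y j` (covering the sites just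
outside `D_0(L')`, away from `D_0(L')`). -/
theorem annulus_crossing_cascade
    (d : ℕ) (hd : 1 ≤ d) (L L' : ℝ) (hL : 0 < 2 * L) (hLL' : 2 * L ≤ L')
    (ω : Site d → Bool) {I J : Type*} [Finite I] [Finite J]
    (x : I → Site d) (y : J → Site d)
    (ha : ∀ i, ∀ t, (0 : ℝ) ≤ (x i t : ℝ) ∧ (x i t : ℝ) < L')
    (hb : boxC (0 : Site d) L' ⊆ ⋃ i, boxC (x i) L)
    (hc : ∀ j, ¬ ∃ p : Fin d → ℝ,
      (∀ t, (y j t : ℝ) ≤ p t ∧ p t < (y j t : ℝ) + L) ∧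
      (∀ t, -L' ≤ p t ∧ p t < 2 * L'))
    (hd' : ∀ z : Site d, z ∉ boxD (0 : Site d) L' →
      (∃ w ∈ boxD (0 : Site d) L', dist1 z w = 1) → z ∈ ⋃ j, boxC (y j) L)
    (hω : ω ∈ annulusEvent (0 : Site d) L') :
    ∃ i j, ω ∈ annulusEvent (x i) L ∧ ω ∈ annulusEvent (y j) L := by
  have hL0 : 0 < L := by linarith
  obtain ⟨a, ha0, b, hb0, hbw, hab⟩ :=
    Connects.exists_first_exit hω (boxC_subset_boxD 0 (by linarith))
  obtain ⟨i, hi⟩ := Set.mem_iUnion.mp (hb ha0)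
  obtain ⟨j, hj⟩ := Set.mem_iUnion.mp (hd' b hb0 hbw)
  refine ⟨i, j, hab.mono (Set.singleton_subset_iff.mpr hi) (Set.singleton_subset_iff.mpr ?_),
    hab.symm.mono (Set.singleton_subset_iff.mpr hj) (Set.singleton_subset_iff.mpr ?_)⟩
  · exact fun h => hb0 (boxD_subset_boxD_zero hL0.le hLL' (ha i) h)
  · exact boxC_zero_subset_compl_boxD hL0 (by linarith) (hc j) ha0
end

section
/- For every real λ > 0 and every natural number n ≥ 1, e^(−λ) · Σ_{m=n}^∞ 4^m · ( Σ_{j=m}^∞ λ^j/j! ) ≤ e^(4λ) · (4λ)^n / (n/2)^(n/2). -/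
theorem pow_div_factorial_add_le {x : ℝ} (hx : 0 ≤ x) (n j : ℕ) :
    x ^ (n + j) / (n + j).factorial ≤ x ^ n / n.factorial * (x ^ j / j.factorial) := by
  rw [div_mul_div_comm, ← pow_add]
  have h : ((n.factorial : ℝ) * j.factorial) ≤ (n + j).factorial := by
    exact_mod_cast Nat.le_of_dvd (Nat.factorial_pos _) (Nat.factorial_mul_factorial_dvd_factorial_add n j)
  gcongr

theorem summable_pow_add_div_factorial (x : ℝ) (n : ℕ) :
    Summable fun j : ℕ => x ^ (n + j) / (n + j).factorial :=
  (Real.summable_pow_div_factorial x).comp_injective (add_right_injective n)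

theorem tsum_pow_add_div_factorial_le {x : ℝ} (hx : 0 ≤ x) (n : ℕ) :
    ∑' j : ℕ, x ^ (n + j) / (n + j).factorial ≤ x ^ n / n.factorial * Real.exp x := by
  have hexp : Real.exp x = ∑' j : ℕ, x ^ j / j.factorial := by
    rw [Real.exp_eq_exp_ℝ, NormedSpace.exp_eq_tsum_div]
  rw [hexp, ← tsum_mul_left]
  exact (summable_pow_add_div_factorial x n).tsum_le_tsum (pow_div_factorial_add_le hx n)
    ((Real.summable_pow_div_factorial x).mul_left _)

theorem pow_self_le_factorial_sq (n : ℕ) : n ^ n ≤ n.factorial ^ 2 := by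
  have h : n.factorial ^ 2 = ∏ i ∈ Finset.range n, (n - 1 - i + 1) * (i + 1) := by
    rw [Finset.prod_mul_distrib, Finset.prod_range_reflect (fun i => i + 1) n,
      Finset.prod_range_add_one_eq_factorial, sq]
  rw [h]
  calc n ^ n = ∏ _i ∈ Finset.range n, n := by simp
    _ ≤ _ := Finset.prod_le_prod' fun i hi => by
      obtain ⟨k, rfl⟩ := Nat.exists_eq_add_of_lt (Finset.mem_range.1 hi)
      have : i + k + 1 - 1 - i = k := by omega
      rw [this]
      nlinarith [Nat.zero_le (k * i)]

theorem half_rpow_half_le_factorial (n : ℕ) :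
    ((n : ℝ) / 2) ^ ((n : ℝ) / 2) ≤ n.factorial := by
  have hn : (0 : ℝ) ≤ n := n.cast_nonneg
  refine le_of_pow_le_pow_left₀ two_ne_zero (Nat.cast_nonneg _) ?_
  calc (((n : ℝ) / 2) ^ ((n : ℝ) / 2)) ^ 2 = ((n : ℝ) / 2) ^ n := by
        rw [← Real.rpow_mul_natCast (by positivity), Nat.cast_ofNat,
          div_mul_cancel₀ _ two_ne_zero, Real.rpow_natCast]
    _ ≤ (n : ℝ) ^ n := by gcongr; linarith
    _ ≤ _ := by exact_mod_cast pow_self_le_factorial_sq n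

/-- The tail bound
`e^{-λ} Σ_{m ≥ n} 4^m P[Poisson(λ) ≥ m] ≤ e^{4λ} (4λ)^n / (n/2)^{n/2}`. -/
theorem poisson_tail_series_bound (lam : ℝ) (hlam : 0 < lam) (n : ℕ) (hn : 1 ≤ n) :
    Real.exp (-lam) *
        ∑' m : ℕ, (4 : ℝ) ^ (n + m) *
          ∑' j : ℕ, lam ^ (n + m + j) / (Nat.factorial (n + m + j)) ≤
      Real.exp (4 * lam) * (4 * lam) ^ n / ((n : ℝ) / 2) ^ ((n : ℝ) / 2) := by
  have hterm (m : ℕ) : (4 : ℝ) ^ (n + m) *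
      ∑' j : ℕ, lam ^ (n + m + j) / (Nat.factorial (n + m + j)) ≤
      Real.exp lam * ((4 * lam) ^ (n + m) / (n + m).factorial) := by
    calc _ ≤ (4 : ℝ) ^ (n + m) * (lam ^ (n + m) / (n + m).factorial * Real.exp lam) := by
          gcongr
          exact tsum_pow_add_div_factorial_le hlam.le _
      _ = _ := by rw [mul_pow]; ring
  have hsum := (summable_pow_add_div_factorial (4 * lam) n).mul_left (Real.exp lam)
  have hle := (hsum.of_nonneg_of_le
    (fun m => mul_nonneg (by positivity) (tsum_nonneg fun j => by positivity))
    hterm).tsum_le_tsum hterm hsum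
  rw [tsum_mul_left] at hle
  have hpos : (0 : ℝ) < n := by exact_mod_cast hn
  calc _ ≤ Real.exp (-lam) * (Real.exp lam *
        ∑' m : ℕ, (4 * lam) ^ (n + m) / (n + m).factorial) := by gcongr
    _ = ∑' m : ℕ, (4 * lam) ^ (n + m) / (n + m).factorial := by
        rw [← mul_assoc, ← Real.exp_add, neg_add_cancel, Real.exp_zero, one_mul]
    _ ≤ (4 * lam) ^ n / n.factorial * Real.exp (4 * lam) :=
        tsum_pow_add_div_factorial_le (by positivity) n
    _ = Real.exp (4 * lam) * (4 * lam) ^ n / n.factorial := by ring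
    _ ≤ _ := by
        gcongr
        exact half_rpow_half_le_factorial n
end

section
/- For every real λ > 0 and every natural number n ≥ 1 with n ≥ (16λ)^8, e^(4λ) · (4λ)^n / (n/2)^(n/2) ≤ exp(−(1/8)·n·log n). -/
/-- For `n ≥ (16λ)^8`, one has
`e^{4λ} (4λ)^n / (n/2)^{n/2} ≤ exp(-(1/8) n log n)`. -/
theorem cone_of_light_final_estimate (lam : ℝ) (hlam : 0 < lam) (n : ℕ) (hn : 1 ≤ n)
    (hbig : (16 * lam) ^ 8 ≤ (n : ℝ)) :
    Real.exp (4 * lam) * (4 * lam) ^ n / ((n : ℝ) / 2) ^ ((n : ℝ) / 2) ≤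
      Real.exp (-(1 / 8 : ℝ) * n * Real.log n) := by
  have hn1 : (1 : ℝ) ≤ n := by exact_mod_cast hn
  have hn0 : (0 : ℝ) < n := by linarith
  have hlam_le : 16 * lam ≤ n := by
    rcases le_total (16 * lam) 1 with h | h
    · linarith
    · exact (le_self_pow₀ h (by norm_num)).trans hbig
  have hlog16 : 8 * Real.log (16 * lam) ≤ Real.log n := by
    have h := Real.log_le_log (by positivity) hbig
    rw [Real.log_pow] at h
    exact_mod_cast h
  have hlog4 : Real.log (16 * lam) = 2 * Real.log 2 + Real.log (4 * lam) := by
    rw [show 16 * lam = 2 ^ 2 * (4 * lam) by ring,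
      Real.log_mul (by norm_num) (by positivity), Real.log_pow]
    norm_num
  have hL : 0 ≤ Real.log n := Real.log_nonneg hn1
  have hlog2 := Real.log_two_gt_d9
  have hpow : (4 * lam) ^ n = Real.exp (Real.log (4 * lam) * n) := by
    rw [← Real.rpow_natCast, Real.rpow_def_of_pos (by positivity)]
  rw [hpow, Real.rpow_def_of_pos (by positivity), ← Real.exp_add, ← Real.exp_sub,
    Real.exp_le_exp, Real.log_div hn0.ne' two_ne_zero]
  have h1 : Real.log (4 * lam) * n ≤ (Real.log n / 8 - 2 * Real.log 2) * n :=
    mul_le_mul_of_nonneg_right (by linarith) hn0.le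
  have h2 : 0 ≤ n * Real.log n := by positivity
  have h3 : 0.6931471803 * (n : ℝ) ≤ Real.log 2 * n :=
    mul_le_mul_of_nonneg_right hlog2.le hn0.le
  linarith
end
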